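/- Let (M, D, ∇) and (M', D', ∇') be vector spaces over K = k((u)) equipped with differentials and u-connections, and let (ι, p) be a u-homotopy equivalence between (M, D) and (M', D') (so ι : M → M' and p : M' → M are chain maps with p ∘ ι u-homotopic to id_M and ι ∘ p u-homotopic to id_{M'}). If one of the two maps ι, p is a morphism of u-connections (ι from (M, D, ∇) to (M', D', ∇'), respectively p from (M', D', ∇') to (M, D, ∇)), then so is the other. -/

import Mathlib

/-- The variable `u` of the field `K = k((u))` of formal Laurent series. -/
noncomputable def uVar (k : Type*) [Field k] : LaurentSeries k :=
  HahnSeries.single (1 : ℤ) (1 : k)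

/-- The commutator `nabla' ∘ f - f ∘ nabla` of a linear map with two connections is linear. -/
def connectionCommutator {K M M' : Type*} [CommRing K] [AddCommGroup M] [Module K M]
    [AddCommGroup M'] [Module K M'] (δ : K → K) (nabla : M →+ M)
    (hL : ∀ (c : K) (m : M), nabla (c • m) = δ c • m + c • nabla m)
    (nabla' : M' →+ M')
    (hL' : ∀ (c : K) (m' : M'), nabla' (c • m') = δ c • m' + c • nabla' m')
    (f : M →ₗ[K] M') : M →ₗ[K] M' where
  toFun m := nabla' (f m) - f (nabla m)
  map_add' x y := by
    simp only [map_add]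
    abel
  map_smul' c x := by
    simp only [map_smul, hL, hL', map_add, RingHom.id_apply, smul_sub]
    abel

/-- A homotopy inverse `p` of a morphism of connections `iota` is a morphism of connections.
The relation between connection and differential is `[nabla, D] = a • D` for a scalar `a`. -/
theorem exists_connection_homotopy_of_homotopy_inverse
    {K M M' : Type*} [CommRing K] [AddCommGroup M] [Module K M]
    [AddCommGroup M'] [Module K M'] (δ : K → K) (a : K)
    (D : M →ₗ[K] M) (D' : M' →ₗ[K] M') (nabla : M →+ M)
    (hL : ∀ (c : K) (m : M), nabla (c • m) = δ c • m + c • nabla m)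
    (hC : ∀ m : M, nabla (D m) - D (nabla m) = a • D m)
    (nabla' : M' →+ M')
    (hL' : ∀ (c : K) (m' : M'), nabla' (c • m') = δ c • m' + c • nabla' m')
    (hC' : ∀ m' : M', nabla' (D' m') - D' (nabla' m') = a • D' m')
    (iota : M →ₗ[K] M') (p : M' →ₗ[K] M) (hp : ∀ m', p (D' m') = D (p m'))
    (hpi : ∃ H : M →ₗ[K] M, ∀ m, p (iota m) - m = D (H m) + H (D m))
    (hip : ∃ H' : M' →ₗ[K] M', ∀ m', iota (p m') - m' = D' (H' m') + H' (D' m'))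
    (h : ∃ G : M →ₗ[K] M', ∀ m,
      nabla' (iota m) - iota (nabla m) = D' (G m) + G (D m)) :
    ∃ G' : M' →ₗ[K] M, ∀ m',
      nabla (p m') - p (nabla' m') = D (G' m') + G' (D' m') := by
  obtain ⟨H, hH⟩ := hpi
  obtain ⟨H', hH'⟩ := hip
  obtain ⟨G, hG⟩ := h
  let X := connectionCommutator δ nabla' hL' nabla hL p
  let Z := connectionCommutator δ nabla hL nabla hL H
  have X_apply (m') : X m' = nabla (p m') - p (nabla' m') := rfl
  have Z_apply (m) : Z m = nabla (H m) - H (nabla m) := rfl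
  have X_chain (m') : X (D' m') = D (X m') := by
    have h₁ := hC (p m')
    have h₂ := congrArg p (hC' m')
    simp only [map_sub, map_smul, hp] at h₁ h₂
    simp only [X_apply, map_sub, hp]
    rw [← sub_eq_zero, ← sub_eq_zero.mpr (h₁.trans h₂.symm)]
    abel
  have X_iota (m) : X (iota m) =
      D (Z m + a • H m) + (Z (D m) + a • H (D m)) - (D (p (G m)) + p (G (D m))) := by
    have h₁ := congrArg nabla (hH m)
    have h₂ := hH (nabla m)
    have h₃ := congrArg p (hG m)
    have h₄ := hC (H m)
    have h₅ := congrArg H (hC m)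
    simp only [map_sub, map_add, map_smul, hp] at h₁ h₂ h₃ h₄ h₅
    simp only [X_apply, Z_apply, map_sub, map_add, map_smul]
    rw [← h₄, ← h₅, ← h₃]
    rw [sub_eq_iff_eq_add] at h₁ h₂
    rw [h₁, h₂]
    abel
  refine ⟨(Z + a • H) ∘ₗ p - p ∘ₗ G ∘ₗ p - X ∘ₗ H', fun m' => ?_⟩
  have h₁ := congrArg X (hH' m')
  simp only [map_sub, map_add, X_chain] at h₁
  rw [X_iota, sub_eq_iff_eq_add, ← sub_eq_iff_eq_add'] at h₁
  rw [← X_apply, ← h₁]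
  simp only [LinearMap.sub_apply, LinearMap.comp_apply, LinearMap.add_apply,
    LinearMap.smul_apply, map_sub, map_add, hp]
  abel

/-- Let `(iota, p)` be a `u`-homotopy equivalence between `(M, D)` and
`(M', D')`, both equipped with `u`-connections.  If one of the two maps `iota`, `p` is a
morphism of `u`-connections, then so is the other. -/
theorem connection_morphism_of_homotopy_inverse
    {k : Type*} [Field k] (h2 : (2 : k) ≠ 0)
    (δ : Derivation k (LaurentSeries k) (LaurentSeries k)) (hδ : δ (uVar k) = 1)
    {M M' : Type*} [AddCommGroup M] [Module (LaurentSeries k) M]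
    [AddCommGroup M'] [Module (LaurentSeries k) M']
    (D : M →ₗ[LaurentSeries k] M) (hD : ∀ m, D (D m) = 0)
    (D' : M' →ₗ[LaurentSeries k] M') (hD' : ∀ m', D' (D' m') = 0)
    (nabla : M →+ M)
    (hL : ∀ (c : LaurentSeries k) (m : M), nabla (c • m) = δ c • m + c • nabla m)
    (hC : ∀ m : M, nabla (D m) - D (nabla m) = (2 * uVar k)⁻¹ • D m)
    (nabla' : M' →+ M')
    (hL' : ∀ (c : LaurentSeries k) (m' : M'), nabla' (c • m') = δ c • m' + c • nabla' m')
    (hC' : ∀ m' : M', nabla' (D' m') - D' (nabla' m') = (2 * uVar k)⁻¹ • D' m')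
    (iota : M →ₗ[LaurentSeries k] M') (hiota : ∀ m, iota (D m) = D' (iota m))
    (p : M' →ₗ[LaurentSeries k] M) (hp : ∀ m', p (D' m') = D (p m'))
    (hpi : ∃ H : M →ₗ[LaurentSeries k] M, ∀ m, p (iota m) - m = D (H m) + H (D m))
    (hip : ∃ H' : M' →ₗ[LaurentSeries k] M', ∀ m',
      iota (p m') - m' = D' (H' m') + H' (D' m')) :
    ((∃ G : M →ₗ[LaurentSeries k] M', ∀ m,
        nabla' (iota m) - iota (nabla m) = D' (G m) + G (D m)) →
      (∃ G' : M' →ₗ[LaurentSeries k] M, ∀ m',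
        nabla (p m') - p (nabla' m') = D (G' m') + G' (D' m'))) ∧
    ((∃ G' : M' →ₗ[LaurentSeries k] M, ∀ m',
        nabla (p m') - p (nabla' m') = D (G' m') + G' (D' m')) →
      (∃ G : M →ₗ[LaurentSeries k] M', ∀ m,
        nabla' (iota m) - iota (nabla m) = D' (G m) + G (D m))) := by
  exact ⟨exists_connection_homotopy_of_homotopy_inverse δ _ D D' nabla hL hC nabla' hL' hC'
      iota p hp hpi hip,
    exists_connection_homotopy_of_homotopy_inverse δ _ D' D nabla' hL' hC' nabla hL hC
      p iota hiota hip hpi⟩
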